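/- Let S be a finite set of N nodes, C a type of candidates with at least two distinct elements, and q a natural number with 1 ≤ q ≤ N. Then the following are equivalent: (i) N < 2q; (ii) for every vote function vote : S → Option C, there do not exist distinct candidates c1 ≠ c2 such that both {u ∈ S | vote u = some c1} and {u ∈ S | vote u = some c2} have cardinality at least q. (With majority-sized view-change quorums, at most one leader can be elected per view; with smaller quorums, two leaders can be elected simultaneously.) -/

import Mathlib

/-- Unique leader election (Raft safety condition 2): `N < 2q` iff for every
vote function, no two distinct candidates can both gather `≥ q` votes. -/
theorem raft_unique_leader
    {α C : Type*} [DecidableEq α] [DecidableEq C] (S : Finset α) (N : ℕ)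
    (hS : S.card = N) (hC : ∃ c1 c2 : C, c1 ≠ c2) (q : ℕ)
    (hq1 : 1 ≤ q) (hqN : q ≤ N) :
    N < 2 * q ↔
      ∀ vote : α → Option C,
        ¬ ∃ c1 c2 : C, c1 ≠ c2 ∧
            q ≤ (S.filter fun u => vote u = some c1).card ∧
            q ≤ (S.filter fun u => vote u = some c2).card := by
  constructor
  · rintro h vote ⟨c1, c2, hne, h1, h2⟩
    have hd : Disjoint (S.filter fun u => vote u = some c1)
        (S.filter fun u => vote u = some c2) := by
      rw [Finset.disjoint_left]
      intro u hu hu'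
      have e1 := (Finset.mem_filter.mp hu).2
      have e2 := (Finset.mem_filter.mp hu').2
      rw [e1] at e2
      exact hne (Option.some.inj e2)
    have hc := Finset.card_union_of_disjoint hd
    have hle := Finset.card_le_card (Finset.union_subset
      (Finset.filter_subset (fun u => vote u = some c1) S)
      (Finset.filter_subset (fun u => vote u = some c2) S))
    omega
  · intro h
    by_contra hlt
    obtain ⟨c1, c2, hne⟩ := hC
    obtain ⟨T, hTS, hT⟩ := Finset.exists_subset_card_eq (s := S) (n := q) (by omega)
    apply h (fun u => if u ∈ T then some c1 else some c2)
    refine ⟨c1, c2, hne, ?_, ?_⟩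
    · rw [← hT]
      apply Finset.card_le_card
      intro u hu
      simp [hu, hTS hu]
    · have hs := Finset.card_sdiff_add_card_eq_card hTS
      have : q ≤ (S \ T).card := by omega
      refine this.trans (Finset.card_le_card ?_)
      intro u hu
      have hu' := Finset.mem_sdiff.mp hu
      simp [hu'.1, hu'.2]
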